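/- Let n be a squarefree even positive integer, d a positive integer, and b ∈ ℤ^d with every coordinate b_i odd. Then g_n(b) = Σ_{0 ≤ k < n, gcd(k,n)=1} e_{4n}(−k'·(b·b)) · (G_{4n}(k)/2)^d, where for each such k, k' is any integer with k·k' ≡ 1 (mod 4n) (such k' exists since k is odd and coprime to n), and G_{4n}(k) = Σ_{j=0}^{4n-1} e_{4n}(k j²). -/

import Mathlib

open Finset

/-- `en n x = exp(2πi x / n)` -/
noncomputable def en (n : ℕ) (x : ℤ) : ℂ := Complex.exp (2 * Real.pi * Complex.I * x / n)

/-- `g_n(b) = Σ_{0 ≤ k < n, gcd(k,n)=1} Σ_{x ∈ {0,…,n-1}^d} e_n(b·x + k(x·x))`. -/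
noncomputable def gsum (n d : ℕ) (b : Fin d → ℤ) : ℂ :=
  ∑ k ∈ (Finset.range n).filter (fun k => Nat.gcd k n = 1),
    ∑ x ∈ Fintype.piFinset fun _ : Fin d => Finset.Ico (0:ℤ) n,
      en n (∑ i, b i * x i + k * ∑ i, x i ^ 2)

/-- The Gauss sum `G_m(c) = Σ_{j=0}^{m-1} e_m(c j²)`. -/
noncomputable def gauss (m : ℕ) (c : ℤ) : ℂ := ∑ j ∈ Finset.range m, en m (c * j ^ 2)

lemma en_add (n : ℕ) (x y : ℤ) : en n (x + y) = en n x * en n y := by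
  simp only [en, ← Complex.exp_add]
  congr 1
  push_cast
  ring

lemma en_zero (n : ℕ) : en n 0 = 1 := by simp [en]

lemma en_sum {ι : Type*} (n : ℕ) (s : Finset ι) (f : ι → ℤ) :
    en n (∑ i ∈ s, f i) = ∏ i ∈ s, en n (f i) := by
  classical
  induction s using Finset.induction_on with
  | empty => simp [en_zero]
  | insert a s ha ih => rw [Finset.sum_insert ha, Finset.prod_insert ha, en_add, ih]

lemma en_mul_mul {n m : ℕ} (hm : m ≠ 0) (x : ℤ) : en (m * n) (m * x) = en n x := by
  have hm' : (m : ℂ) ≠ 0 := Nat.cast_ne_zero.mpr hm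
  unfold en
  congr 1
  push_cast
  rw [show 2 * (Real.pi : ℂ) * Complex.I * (m * x) = m * (2 * Real.pi * Complex.I * x) by ring,
    mul_div_mul_left _ _ hm']

lemma en_self_mul {n : ℕ} (hn : n ≠ 0) (x : ℤ) : en n (n * x) = 1 := by
  have h := en_mul_mul (n := 1) hn x
  rw [mul_one] at h
  rw [h, en, Nat.cast_one, div_one, mul_comm]
  exact Complex.exp_int_mul_two_pi_mul_I x

lemma en_congr {n : ℕ} (hn : n ≠ 0) {x y : ℤ} (h : x ≡ y [ZMOD n]) : en n x = en n y := by
  obtain ⟨t, ht⟩ := h.dvd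
  rw [show y = x + n * t by linarith, en_add, en_self_mul hn, mul_one]

lemma en_two_of_odd {x : ℤ} (hx : Odd x) : en 2 x = -1 := by
  obtain ⟨t, rfl⟩ := hx
  have h : en 2 (2 * t) = 1 := en_self_mul (n := 2) two_ne_zero t
  rw [en_add, h, one_mul, en, ← Complex.exp_pi_mul_I]
  congr 1
  push_cast
  ring

/-- A sum over a full period is invariant under translation. -/
lemma sum_range_translate {M : Type*} [AddCommGroup M] {f : ℤ → M} {n : ℕ}
    (hf : Function.Periodic f n) (t : ℤ) :
    ∑ j ∈ Finset.range n, f (j + t) = ∑ j ∈ Finset.range n, f j := by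
  have step (t : ℤ) :
      ∑ j ∈ Finset.range n, f (j + (t + 1)) = ∑ j ∈ Finset.range n, f (j + t) := by
    have h := (Finset.sum_range_succ' (fun j : ℕ => f (j + t)) n).symm.trans
      (Finset.sum_range_succ (fun j : ℕ => f (j + t)) n)
    rw [show f ((n : ℤ) + t) = f (((0 : ℕ) : ℤ) + t) by
      rw [add_comm, hf, Nat.cast_zero, zero_add]] at h
    rw [← add_right_cancel h]
    refine Finset.sum_congr rfl fun j _ => ?_
    push_cast
    congr 1
    ring
  induction t using Int.induction_on with
  | zero => simp
  | succ i ih => rw [step, ih]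
  | pred i ih => rw [← ih, ← step (-i - 1), sub_add_cancel]

lemma sum_range_two_mul {M : Type*} [AddCommMonoid M] (f : ℕ → M) (n : ℕ) :
    ∑ j ∈ Finset.range (2 * n), f j =
      ∑ j ∈ Finset.range n, f (2 * j) + ∑ j ∈ Finset.range n, f (2 * j + 1) := by
  induction n with
  | zero => simp
  | succ n ih =>
    rw [show 2 * (n + 1) = 2 * n + 1 + 1 by ring, Finset.sum_range_succ, Finset.sum_range_succ, ih,
      Finset.sum_range_succ, Finset.sum_range_succ]
    abel

/-- The quadratic Gauss sum vanishes when the modulus is `2` modulo `4`. -/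
lemma gauss_two_mul_eq_zero {m : ℕ} (hm : Odd m) {k : ℤ} (hk : Odd k) : gauss (2 * m) k = 0 := by
  have hm0 : m ≠ 0 := hm.pos.ne'
  have hm2 : 2 * m ≠ 0 := mul_ne_zero two_ne_zero hm0
  have hper : Function.Periodic (fun j : ℤ => en (2 * m) (k * j ^ 2)) (2 * m : ℕ) := by
    intro j
    refine en_congr hm2 (Int.modEq_iff_dvd.mpr ⟨-(k * (2 * j + 2 * m)), ?_⟩)
    push_cast
    ring
  have hneg (j : ℤ) : en (2 * m) (k * (j + m) ^ 2) = -en (2 * m) (k * j ^ 2) := by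
    have hodd : Odd (k * m) := hk.mul (by exact_mod_cast hm)
    have hval : en (2 * m) (m * (k * m)) = -1 := by
      rw [mul_comm 2 m, en_mul_mul hm0, en_two_of_odd hodd]
    rw [show k * (j + m) ^ 2 = k * j ^ 2 + (m * (k * m) + (2 * m : ℕ) * (k * j)) by
      push_cast; ring, en_add, en_add, en_self_mul hm2, hval]
    ring
  have h := sum_range_translate hper m
  simp only [hneg, Finset.sum_neg_distrib] at h
  exact self_eq_neg.mp h.symm

lemma periodic_en_four_mul {n : ℕ} (hn : n ≠ 0) (k : ℤ) :
    Function.Periodic (fun j : ℤ => en (4 * n) (k * j ^ 2)) (2 * n : ℕ) := by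
  intro j
  refine en_congr (mul_ne_zero four_ne_zero hn)
    (Int.modEq_iff_dvd.mpr ⟨-(k * (j + n)), ?_⟩)
  push_cast
  ring

/-- When `n` is `2` modulo `4`, only odd residues contribute to the Gauss sum modulo `4 n`. -/
lemma gauss_four_mul_div_two {m : ℕ} (hm : Odd m) {k : ℤ} (hk : Odd k) :
    gauss (4 * (2 * m)) k / 2 =
      ∑ j ∈ Finset.range (2 * m), en (4 * (2 * m)) (k * (2 * (j : ℤ) + 1) ^ 2) := by
  have hn : 2 * m ≠ 0 := mul_ne_zero two_ne_zero hm.pos.ne'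
  have hper := periodic_en_four_mul hn k
  have heven : ∑ j ∈ Finset.range (2 * m), en (4 * (2 * m)) (k * (2 * (j : ℤ)) ^ 2) = 0 := by
    rw [← gauss_two_mul_eq_zero hm hk, gauss]
    refine Finset.sum_congr rfl fun j _ => ?_
    rw [← en_mul_mul four_ne_zero (k * (j : ℤ) ^ 2)]
    congr 1
    push_cast
    ring
  have hhalf : ∑ j ∈ Finset.range (2 * (2 * m)), en (4 * (2 * m)) (k * (j : ℤ) ^ 2) =
      ∑ j ∈ Finset.range (2 * m), en (4 * (2 * m)) (k * (2 * (j : ℤ) + 1) ^ 2) := by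
    rw [sum_range_two_mul]
    push_cast
    rw [heven, zero_add]
  have hsplit : gauss (4 * (2 * m)) k =
      2 * ∑ j ∈ Finset.range (2 * (2 * m)), en (4 * (2 * m)) (k * (j : ℤ) ^ 2) := by
    rw [gauss, show Finset.range (4 * (2 * m)) = Finset.range (2 * (2 * m) + 2 * (2 * m)) by
      congr 1; ring, Finset.sum_range_add, two_mul (∑ j ∈ _, _)]
    congr 1
    refine Finset.sum_congr rfl fun j _ => ?_
    rw [Nat.cast_add, add_comm]
    exact hper j
  rw [hsplit, hhalf, mul_div_cancel_left₀ _ two_ne_zero]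

/-- Completing the square in a one-dimensional quadratic exponential sum with odd linear term. -/
lemma sum_en_quadratic {m : ℕ} (hm : Odd m) {k k' b : ℤ} (hk : Odd k) (hb : Odd b)
    (hkk' : k * k' ≡ 1 [ZMOD (4 * (2 * m) : ℕ)]) :
    ∑ x ∈ Finset.range (2 * m), en (2 * m) (b * x + k * (x : ℤ) ^ 2) =
      en (4 * (2 * m)) (-k' * b ^ 2) * (gauss (4 * (2 * m)) k / 2) := by
  have hn : 2 * m ≠ 0 := mul_ne_zero two_ne_zero hm.pos.ne'
  have hk' : Odd k' := by
    refine Int.not_even_iff_odd.mp fun ⟨s, hs⟩ => ?_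
    obtain ⟨t, ht⟩ := hkk'.dvd
    subst hs
    push_cast at ht
    have : 2 * (4 * (m * t) + k * s) = 1 := by linarith
    omega
  obtain ⟨c, hc⟩ := hb.mul hk'
  have hper : Function.Periodic
      (fun j : ℤ => en (4 * (2 * m)) (k * (2 * j + 1) ^ 2)) (2 * m : ℕ) := by
    intro j
    have h := periodic_en_four_mul hn k (2 * j + 1)
    simp only at h ⊢
    rw [← h]
    congr 3
    push_cast
    ring
  rw [gauss_four_mul_div_two hm hk, ← sum_range_translate hper c, Finset.mul_sum]
  refine Finset.sum_congr rfl fun x _ => ?_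
  rw [← en_add, ← en_mul_mul four_ne_zero (n := 2 * m)]
  refine en_congr (mul_ne_zero four_ne_zero hn) ?_
  rw [show 2 * ((x : ℤ) + c) + 1 = 2 * x + b * k' by rw [mul_add, add_assoc, ← hc]]
  obtain ⟨t, ht⟩ := hkk'.symm.dvd
  refine Int.modEq_iff_dvd.mpr ⟨t * (4 * b * x + b ^ 2 * k'), ?_⟩
  push_cast at ht ⊢
  linear_combination (4 * b * x + b ^ 2 * k') * ht

/-- The multidimensional exponential sum of a diagonal quadratic form factors over coordinates. -/
lemma sum_piFinset_en (n d : ℕ) (b : Fin d → ℤ) (k : ℤ) :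
    ∑ x ∈ Fintype.piFinset fun _ : Fin d => Finset.Ico (0 : ℤ) n,
        en n (∑ i, b i * x i + k * ∑ i, x i ^ 2) =
      ∏ i, ∑ x ∈ Finset.range n, en n (b i * x + k * (x : ℤ) ^ 2) := by
  have h (i : Fin d) : ∑ x ∈ Finset.range n, en n (b i * x + k * (x : ℤ) ^ 2) =
      ∑ x ∈ Finset.Ico (0 : ℤ) n, en n (b i * x + k * x ^ 2) := by
    refine Finset.sum_nbij (fun x : ℕ => (x : ℤ)) (by simp) (by simp) ?_ (by simp)
    intro y hy
    obtain ⟨hy0, hyn⟩ := Finset.mem_Ico.mp hy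
    exact ⟨y.toNat, by simp; omega, by simp [hy0]⟩
  simp only [h, Finset.prod_univ_sum]
  refine Finset.sum_congr rfl fun x _ => ?_
  rw [Finset.mul_sum, ← Finset.sum_add_distrib, en_sum]

/-- For `n` squarefree even and all `b_i` odd,
`g_n(b) = Σ_{0 ≤ k < n, gcd(k,n)=1} e_{4n}(−k'·(b·b)) (G_{4n}(k)/2)^d`, where `k'` is
any inverse of `k` modulo `4n`. -/
theorem gsum_eq_of_odd_coords (n d : ℕ) (hn : 0 < n) (hsf : Squarefree n) (hev : Even n)
    (hd : 0 < d) (b : Fin d → ℤ) (hb : ∀ i, Odd (b i)) (K : ℕ → ℤ)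
    (hK : ∀ k, Nat.gcd k n = 1 → (k : ℤ) * K k ≡ 1 [ZMOD (4 * n : ℕ)]) :
    gsum n d b = ∑ k ∈ (Finset.range n).filter (fun k => Nat.gcd k n = 1),
      en (4 * n) (-(K k) * ∑ i, b i ^ 2) * (gauss (4 * n) k / 2) ^ d := by
  obtain ⟨m, rfl⟩ := hev.two_dvd
  have hm : Odd m := by
    refine Nat.not_even_iff_odd.mp fun hm => ?_
    exact Nat.isUnit_iff.not.mpr (by norm_num) (hsf 2 (mul_dvd_mul_left 2 hm.two_dvd))
  rw [gsum]
  refine Finset.sum_congr rfl fun k hk => ?_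
  have hcop : Nat.Coprime k (2 * m) := (Finset.mem_filter.mp hk).2
  have hodd : Odd (k : ℤ) := by
    exact_mod_cast Nat.coprime_two_right.mp hcop.coprime_mul_right_right
  rw [sum_piFinset_en, Finset.prod_congr rfl fun i _ =>
    sum_en_quadratic hm hodd (hb i) (hK k hcop), Finset.prod_mul_distrib, ← en_sum,
    ← Finset.mul_sum]
  simp [div_pow]
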